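/- Let X be a metric space, G a group acting on X by η-quasisymmetric homeomorphisms (with a common control function η), and suppose there exist constants 0 < δ₋ ≤ δ₊ such that for every x ∈ X, letting C_x denote the connected component of X containing x, one has dist(C_x, X \ C_x) ≥ δ₋ and dist(x, X \ C_x) ≤ δ₊ (in particular X is disconnected). Then d(x, y) := sup_{g ∈ G} d_X(g(x), g(y)) is finite for all x, y; (X, d) is a metric space on which G acts by isometries; and the identity map (X, d_X) → (X, d) is η-quasisymmetric. -/

import Mathlib

/-- A group acting by maps with a common weak quasisymmetry control acts by continuous maps, even
if the control function does not tend to zero at zero. -/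
theorem continuous_smul_of_quasisymmetric {G X : Type*} [Group G] [MetricSpace X] [MulAction G X]
    {η : ℝ → ℝ}
    (hqs : ∀ (g : G) (x y z : X) (t : ℝ), 0 < t →
      dist x y ≤ t * dist x z → dist (g • x) (g • y) ≤ η t * dist (g • x) (g • z))
    (g : G) : Continuous fun x : X => g • x := by
  rw [Metric.continuous_iff]
  intro x ε hε
  by_contra! hbad
  have hne : ∀ y : X, ε ≤ dist (g • y) (g • x) → 0 < dist x y := by
    intro y hy
    rw [dist_pos]
    rintro rfl
    rw [dist_self] at hy
    linarith
  have hfar : ∀ z : X, 0 < dist x z → ε ≤ η 1 * dist (g • x) (g • z) := by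
    intro z hz
    obtain ⟨y, hyx, hy⟩ := hbad (dist x z) hz
    rw [dist_comm] at hyx hy
    exact hy.trans (hqs g x y z 1 one_pos (by linarith))
  obtain ⟨y, -, hy⟩ := hbad 1 one_pos
  have hxy := hne y hy
  rw [dist_comm] at hy
  have hη1 : 0 < η 1 :=
    pos_of_mul_pos_left (hε.trans_le (hfar y hxy)) dist_nonneg
  have ht : 0 < dist (g • x) (g • y) * η 1 / ε :=
    div_pos (mul_pos (hε.trans_le hy) hη1) hε
  set t := dist (g • x) (g • y) * η 1 / ε with ht_def
  have hpos : 0 < |η t| + 1 := by positivity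
  obtain ⟨z, hzx, hz⟩ := hbad (dist x y / (|η t| + 1)) (div_pos hxy hpos)
  have hxz := hne z hz
  have hle : dist (g • x) (g • y) ≤ t * dist (g • x) (g • z) := by
    rw [ht_def, div_mul_eq_mul_div, le_div_iff₀ hε, mul_assoc]
    exact mul_le_mul_of_nonneg_left (hfar z hxz) dist_nonneg
  have hinv := hqs g⁻¹ (g • x) (g • y) (g • z) t ht hle
  simp only [inv_smul_smul] at hinv
  rw [dist_comm, lt_div_iff₀ hpos] at hzx
  nlinarith [mul_le_mul_of_nonneg_right (le_abs_self (η t)) hxz.le]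

/-- A continuous map sends connected components into connected components. -/
theorem Continuous.map_mem_connectedComponent {X Y : Type*} [TopologicalSpace X]
    [TopologicalSpace Y] {f : X → Y} (hf : Continuous f) {x y : X}
    (h : y ∈ connectedComponent x) : f y ∈ connectedComponent (f x) :=
  hf.image_connectedComponent_subset x (Set.mem_image_of_mem f h)


/-- Conformal elevator: if a group `G` acts on a metric space `X` by `η`-quasisymmetric
maps and the connected components of `X` are uniformly separated (by `δ₋`) and
uniformly close to each point (within `δ₊`), then `d(x,y) = sup_g d(gx, gy)` is a
finite metric on `X` on which `G` acts by isometries, and the identity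
`(X, d_X) → (X, d)` is `η`-quasisymmetric. -/
theorem quasisymmetric_sup_metric {G X : Type*} [Group G] [MetricSpace X]
    [MulAction G X]
    (η : ℝ → ℝ) (hη : Monotone η)
    (hqs : ∀ (g : G) (x y z : X) (t : ℝ), 0 < t →
      dist x y ≤ t * dist x z → dist (g • x) (g • y) ≤ η t * dist (g • x) (g • z))
    (δm δp : ℝ) (hδm : 0 < δm) (hδ : δm ≤ δp)
    (hsep : ∀ x y : X, y ∉ connectedComponent x → δm ≤ dist x y)
    (hnear : ∀ (x : X) (ε : ℝ), 0 < ε →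
      ∃ y : X, y ∉ connectedComponent x ∧ dist x y ≤ δp + ε) :
    (∀ x y : X, BddAbove (Set.range fun g : G => dist (g • x) (g • y))) ∧
    ∀ d : X → X → ℝ, (∀ x y : X, d x y = ⨆ g : G, dist (g • x) (g • y)) →
      (∀ x, d x x = 0) ∧
      (∀ x y, d x y = d y x) ∧
      (∀ x y z, d x z ≤ d x y + d y z) ∧
      (∀ x y, x ≠ y → 0 < d x y) ∧
      (∀ (g : G) (x y : X), d (g • x) (g • y) = d x y) ∧
      (∀ (x y z : X) (t : ℝ), 0 < t → dist x y ≤ t * dist x z →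
        d x y ≤ η t * d x z) := by
  have hcont := continuous_smul_of_quasisymmetric hqs
  have hbdd : ∀ x y : X, BddAbove (Set.range fun g : G => dist (g • x) (g • y)) := by
    intro x y
    rcases eq_or_ne x y with rfl | hxy
    · exact ⟨0, by rintro _ ⟨g, rfl⟩; simp⟩
    have ht : 0 < dist x y / δm := div_pos (dist_pos.2 hxy) hδm
    refine ⟨|η (dist x y / δm)| * (δp + 1), ?_⟩
    rintro _ ⟨g, rfl⟩
    obtain ⟨z, hz, hdz⟩ := hnear (g • x) 1 one_pos
    have hw : g⁻¹ • z ∉ connectedComponent x := fun h => hz <| by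
      simpa using (hcont g).map_mem_connectedComponent h
    have hle : dist x y ≤ dist x y / δm * dist x (g⁻¹ • z) := by
      rw [div_mul_eq_mul_div, le_div_iff₀ hδm]
      exact mul_le_mul_of_nonneg_left (hsep _ _ hw) dist_nonneg
    have h := hqs g x y (g⁻¹ • z) _ ht hle
    rw [smul_inv_smul] at h
    exact h.trans (mul_le_mul (le_abs_self _) hdz dist_nonneg (abs_nonneg _))
  have hη_nonneg : ∀ (x : X) (t : ℝ), 0 < t → 0 ≤ η t := by
    intro x t ht
    obtain ⟨z, hz, -⟩ := hnear x 1 one_pos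
    have hxz : 0 < dist x z := hδm.trans_le (hsep x z hz)
    have h := hqs 1 x x z t ht (by rw [dist_self]; positivity)
    rw [one_smul, one_smul, dist_self] at h
    exact nonneg_of_mul_nonneg_left h hxz
  refine ⟨hbdd, fun d hd => ?_⟩
  have hle : ∀ (g : G) (x y : X), dist (g • x) (g • y) ≤ d x y := fun g x y => by
    rw [hd]
    exact le_ciSup (hbdd x y) g
  refine ⟨fun x => by simp [hd], fun x y => by simp only [hd, dist_comm], fun x y z => ?_,
    fun x y hxy => ?_, fun g x y => ?_, fun x y z t ht h => ?_⟩
  · rw [hd x z]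
    exact ciSup_le fun g => (dist_triangle _ (g • y) _).trans (add_le_add (hle g x y) (hle g y z))
  · have h := hle 1 x y
    rw [one_smul, one_smul] at h
    exact (dist_pos.2 hxy).trans_le h
  · rw [hd, hd]
    simp only [smul_smul]
    exact (Equiv.mulRight g).iSup_comp (g := fun k : G => dist (k • x) (k • y))
  · rw [hd x y]
    exact ciSup_le fun g => (hqs g x y z t ht h).trans
      (mul_le_mul_of_nonneg_left (hle g x z) (hη_nonneg x t ht))
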